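/- arXiv:gr-qc/0301028 — 2 statements merged into one kernel-verified Lean document; each statement's English description precedes it below -/
import Mathlib

section
/- Let R > 0, m > 0 and E ∈ ℝ satisfy E + m/R > 0. Then the maximal solution r(t) of the characteristic ODE dr/dt = -√(E + m/r) with r(0) = R is strictly decreasing, remains in (0, R], and reaches r = 0 in finite time: there exists T ∈ (0, ∞) such that r(t) > 0 for all t ∈ [0, T) and r(t) → 0 as t → T⁻. -/
open Set Filter Topology

/-- The autonomous equation `dr/dt = -1 / g r`, with `g` continuous and positive on `(0, ∞)`, has
a strictly decreasing solution starting at `R > 0` that reaches `0` at the finite time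
`∫ s in 0..R, g s`. -/
theorem exists_strictAntiOn_hasDerivAt_neg_inv_tendsto_zero {g : ℝ → ℝ} (hg : Continuous g)
    (hpos : ∀ s, 0 < s → 0 < g s) {R : ℝ} (hR : 0 < R) :
    ∃ (T : ℝ) (r : ℝ → ℝ), 0 < T ∧ r 0 = R ∧
      (∀ t ∈ Ico (0 : ℝ) T, HasDerivAt r (-(g (r t))⁻¹) t) ∧
      StrictAntiOn r (Ico 0 T) ∧
      (∀ t ∈ Ico (0 : ℝ) T, r t ∈ Ioc 0 R) ∧
      Tendsto r (𝓝[<] T) (𝓝 0) := by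
  set G : ℝ → ℝ := fun x => ∫ s in (0 : ℝ)..x, g s with hG
  have hG0 : G 0 = 0 := by simp [hG]
  have hderiv : ∀ x, HasDerivAt G (g x) x := fun x => hg.integral_hasStrictDerivAt 0 x |>.hasDerivAt
  have hcont : Continuous G := continuous_iff_continuousAt.2 fun x => (hderiv x).continuousAt
  have hmono : StrictMonoOn G (Ici 0) := by
    refine strictMonoOn_of_deriv_pos (convex_Ici 0) hcont.continuousOn fun x hx => ?_
    rw [interior_Ici] at hx
    rw [(hderiv x).deriv]
    exact hpos x hx
  have hmapsTo : ∀ x, 0 < x → 0 < G x := fun x hx =>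
    hG0 ▸ hmono self_mem_Ici hx.le hx
  have hS : 0 < R + 1 := by linarith
  have hsurj : ∀ y ∈ Ioo 0 (G (R + 1)), ∃ x ∈ Ioo 0 (R + 1), G x = y := by
    have h := intermediate_value_Ioo hS.le hcont.continuousOn
    rw [hG0] at h
    exact h
  choose! ψ hψ_mem hψ_eq using hsurj
  have hψ_left : ∀ x ∈ Ioo 0 (R + 1), ψ (G x) = x := by
    intro x hx
    have hy : G x ∈ Ioo 0 (G (R + 1)) :=
      ⟨hmapsTo x hx.1, hmono hx.1.le hS.le hx.2⟩
    exact hmono.injOn (hψ_mem _ hy).1.le hx.1.le (hψ_eq _ hy)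
  have hψ_mono : StrictMonoOn ψ (Ioo 0 (G (R + 1))) := by
    intro a ha b hb hab
    rw [← hmono.lt_iff_lt (hψ_mem a ha).1.le (hψ_mem b hb).1.le, hψ_eq a ha, hψ_eq b hb]
    exact hab
  have hψ_cont : ∀ y ∈ Ioo 0 (G (R + 1)), ContinuousAt ψ y := by
    intro y hy
    refine hψ_mono.continuousAt_of_image_mem_nhds (Ioo_mem_nhds hy.1 hy.2) ?_
    refine mem_of_superset (Ioo_mem_nhds (hψ_mem y hy).1 (hψ_mem y hy).2) fun x hx => ?_
    exact ⟨G x, ⟨hmapsTo x hx.1, hmono hx.1.le hS.le hx.2⟩, hψ_left x hx⟩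
  have hψ_deriv : ∀ y ∈ Ioo 0 (G (R + 1)), HasDerivAt ψ (g (ψ y))⁻¹ y := by
    intro y hy
    refine HasDerivAt.of_local_left_inverse (hψ_cont y hy) (hderiv (ψ y))
      (hpos _ (hψ_mem y hy).1).ne' ?_
    filter_upwards [Ioo_mem_nhds hy.1 hy.2] with z hz using hψ_eq z hz
  have hψR : ψ (G R) = R := hψ_left R ⟨hR, by linarith⟩
  have hTlt : G R < G (R + 1) := hmono hR.le hS.le (by linarith)
  have harg : ∀ t ∈ Ico 0 (G R), G R - t ∈ Ioo 0 (G (R + 1)) := fun t ht =>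
    ⟨by linarith [ht.2], by linarith [ht.1]⟩
  refine ⟨G R, fun t => ψ (G R - t), hmapsTo R hR, by simpa using hψR, ?_, ?_, ?_, ?_⟩
  · intro t ht
    exact (hψ_deriv _ (harg t ht)).comp_const_sub (G R) t
  · intro a ha b hb hab
    exact hψ_mono (harg b hb) (harg a ha) (by linarith)
  · intro t ht
    refine ⟨(hψ_mem _ (harg t ht)).1, ?_⟩
    calc ψ (G R - t) ≤ ψ (G R) :=
          hψ_mono.monotoneOn (harg t ht) ⟨hmapsTo R hR, hTlt⟩ (by linarith [ht.1])
      _ = R := hψR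
  · rw [tendsto_order]
    refine ⟨fun a ha => ?_, fun ε hε => ?_⟩
    · filter_upwards [Ioo_mem_nhdsLT (hmapsTo R hR)] with t ht
      exact ha.trans (hψ_mem _ (harg t ⟨ht.1.le, ht.2⟩)).1
    · filter_upwards [Ioo_mem_nhdsLT (hmapsTo R hR),
        Ioo_mem_nhdsLT (sub_lt_self (G R) (hmapsTo ε hε))] with t ht ht'
      have hy := harg t ⟨ht.1.le, ht.2⟩
      rw [← hmono.lt_iff_lt (hψ_mem _ hy).1.le hε.le, hψ_eq _ hy]
      linarith [ht'.1]

/-- For `R > 0`, `m > 0` and `E + m/R > 0`, the maximal solution of the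
characteristic ODE `dr/dt = -√(E + m/r)` with `r 0 = R` is strictly decreasing, stays in
`(0, R]`, and reaches `r = 0` in finite time `T`. -/
theorem characteristic_reaches_zero_in_finite_time
    (R m E : ℝ) (hR : 0 < R) (hm : 0 < m) (hE : 0 < E + m / R) :
    ∃ (T : ℝ) (r : ℝ → ℝ), 0 < T ∧ r 0 = R ∧
      (∀ t ∈ Set.Ico (0:ℝ) T, HasDerivAt r (-Real.sqrt (E + m / r t)) t) ∧
      StrictAntiOn r (Set.Ico 0 T) ∧
      (∀ t ∈ Set.Ico (0:ℝ) T, r t ∈ Set.Ioc 0 R) ∧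
      Tendsto r (nhdsWithin T (Set.Iio T)) (nhds 0) := by
  have hER : 0 < E * R + m := by
    have h := mul_pos hE hR
    rwa [add_mul, div_mul_cancel₀ _ hR.ne'] at h
  -- The denominator is truncated below so that the integrand is continuous on all of `ℝ`.
  set D : ℝ → ℝ := fun s => max (E * s + m) (min m (E * R + m)) with hD
  have hDpos : ∀ s, 0 < D s := fun s => lt_max_of_lt_right (lt_min hm hER)
  have hDcont : Continuous D := by fun_prop
  have hgcont : Continuous fun s => √(s / D s) :=
    (continuous_id.div hDcont fun s => (hDpos s).ne').sqrt
  obtain ⟨T, r, hT, hr0, hr, hanti, hmem, hlim⟩ :=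
    exists_strictAntiOn_hasDerivAt_neg_inv_tendsto_zero hgcont
      (fun s hs => Real.sqrt_pos.2 (div_pos hs (hDpos s))) hR
  refine ⟨T, r, hT, hr0, fun t ht => ?_, hanti, hmem, hlim⟩
  obtain ⟨hpos, hle⟩ := hmem t ht
  have hDr : D (r t) = E * r t + m := by
    refine max_eq_left ?_
    rcases le_total 0 E with h | h
    · exact (min_le_left _ _).trans (le_add_of_nonneg_left (mul_nonneg h hpos.le))
    · exact (min_le_right _ _).trans (by linarith [mul_le_mul_of_nonpos_left hle h])
  convert hr t ht using 2
  rw [hDr, ← Real.sqrt_inv, inv_div, add_div, mul_div_cancel_right₀ _ hpos.ne']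
end

section
/- Let T > 0 and let G : ℝ × [0,T] → ℝ be smooth, bounded, and with bounded x-derivative (hence globally Lipschitz in x uniformly in t). Let φ ∈ C_c^∞( ℝ × (0,T) ). Then there exists a unique smooth function ψ : ℝ × [0,T] → ℝ solving the terminal value problem ψ_t + G ψ_x = φ on ℝ × (0,T) with ψ(x,T) = 0 for all x; moreover ψ has compact support contained in ℝ × [0,T). -/
open Set Filter Topology

universe u

/-- A bounded, globally Lipschitz time-dependent vector field has global integral curves. -/
theorem exists_forall_hasDerivAt_of_lipschitzWith_of_norm_le {E : Type*} [NormedAddCommGroup E]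
    [NormedSpace ℝ E] [CompleteSpace E] {v : ℝ → E → E} {K C : NNReal}
    (hv : ∀ t, LipschitzWith K (v t)) (hc : ∀ x, Continuous (v · x))
    (hb : ∀ t x, ‖v t x‖ ≤ C) (t₀ : ℝ) (x₀ : E) :
    ∃ γ : ℝ → E, γ t₀ = x₀ ∧ ∀ t, HasDerivAt γ (v t (γ t)) t := by
  have hloc : ∀ a : NNReal, ∃ γ : ℝ → E, γ t₀ = x₀ ∧
      ∀ t ∈ Ioo (t₀ - a) (t₀ + a), HasDerivAt γ (v t (γ t)) t := by
    intro a
    have ha : (0 : ℝ) ≤ a := a.2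
    have hpl : IsPicardLindelof v (tmin := t₀ - a) (tmax := t₀ + a)
        ⟨t₀, by constructor <;> linarith⟩ x₀ (C * a) 0 C K :=
      { lipschitzOnWith := fun t _ => (hv t).lipschitzOnWith
        continuousOn := fun x _ => (hc x).continuousOn
        norm_le := fun t _ x _ => hb t x
        mul_max_le := by simp }
    obtain ⟨γ, h0, h1⟩ := hpl.exists_eq_forall_mem_Icc_hasDerivWithinAt₀
    exact ⟨γ, h0, fun t ht => (h1 t (Ioo_subset_Icc_self ht)).hasDerivAt (Icc_mem_nhds ht.1 ht.2)⟩
  choose γ h0 h1 using hloc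
  have hagree : ∀ (a b : NNReal) (t : ℝ), |t - t₀| < a → |t - t₀| < b → γ a t = γ b t := by
    intro a b t ha hb
    have hmin : |t - t₀| < min a b := by simpa using ⟨ha, hb⟩
    have hpos := (abs_nonneg (t - t₀)).trans_lt hmin
    have hs : ∀ c : NNReal, min a b ≤ c →
        ∀ s ∈ Ioo (t₀ - (min a b : NNReal)) (t₀ + (min a b : NNReal)),
        HasDerivAt (γ c) (v s (γ c s)) s ∧ γ c s ∈ (univ : Set E) := fun c hc s hs =>
      have hc' : ((min a b : NNReal) : ℝ) ≤ c := by exact_mod_cast hc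
      ⟨h1 c s ⟨by linarith [hs.1], by linarith [hs.2]⟩, mem_univ _⟩
    rw [abs_lt] at hmin
    exact ODE_solution_unique_of_mem_Ioo (s := fun _ => univ) (K := K)
      (fun s _ => (hv s).lipschitzOnWith) (t₀ := t₀)
      ⟨by linarith, by linarith⟩ (hs a (min_le_left _ _)) (hs b (min_le_right _ _))
      ((h0 a).trans (h0 b).symm) ⟨by linarith, by linarith⟩
  refine ⟨fun t => γ (‖t - t₀‖₊ + 1) t, h0 _, fun t => ?_⟩
  have hnear : ∀ᶠ s in 𝓝 t, |s - t₀| < ((‖t - t₀‖₊ + 1 : NNReal) : ℝ) :=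
    ContinuousAt.eventually_lt (by fun_prop) continuousAt_const (by simp)
  have ht := hnear.self_of_nhds
  rw [abs_lt] at ht
  refine (h1 (‖t - t₀‖₊ + 1) t ⟨by linarith, by linarith⟩).congr_of_eventuallyEq ?_
  filter_upwards [hnear] with s hs
  exact hagree _ _ s (by simp) hs

theorem contDiff_intervalIntegral_const {H : Type u} [NormedAddCommGroup H] [NormedSpace ℝ H]
    [LocallyCompactSpace H] (a b : ℝ) (n : ℕ) :
    ∀ {F : Type u} [NormedAddCommGroup F] [NormedSpace ℝ F] [CompleteSpace F] {f : H × ℝ → F}, ContDiff ℝ n f →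
    ContDiff ℝ n (fun x => ∫ s in a..b, f (x, s)) := by
  induction n with
  | zero =>
    intro F _ _ _ f hf
    simp only [CharP.cast_eq_zero, contDiff_zero] at hf ⊢
    exact intervalIntegral.continuous_parametric_intervalIntegral_of_continuous'
      (f := fun x s => f (x, s)) hf a b
  | succ n ih =>
    intro F _ _ _ f hf
    have hf1 : ContDiff ℝ 1 f := hf.of_le (by norm_cast; omega)
    have hd : ContDiff ℝ n (fun p : H × ℝ => (fderiv ℝ f p).comp (ContinuousLinearMap.inl ℝ H ℝ)) :=
      (hf.fderiv_right le_rfl).clm_comp contDiff_const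
    push_cast
    refine contDiff_succ_iff_hasFDerivAt.2 ⟨_, ih hd, fun x => ?_⟩
    obtain ⟨U, hUc, hU⟩ := exists_compact_mem_nhds x
    obtain ⟨M, hM⟩ := ((hUc.prod (isCompact_uIcc (a := a) (b := b))).bddAbove_image
      hd.continuous.norm.continuousOn)
    refine intervalIntegral.hasFDerivAt_integral_of_dominated_of_fderiv_le
      (F := fun x s => f (x, s)) (bound := fun _ => M)
      (F' := fun x s => (fderiv ℝ f (x, s)).comp (ContinuousLinearMap.inl ℝ H ℝ)) hU ?_ ?_ ?_ ?_ ?_ ?_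
    · exact Eventually.of_forall fun y =>
        (hf.continuous.comp (by fun_prop : Continuous fun s : ℝ => (y, s))).aestronglyMeasurable
    · exact (hf.continuous.comp (by fun_prop : Continuous fun s : ℝ => (x, s))).intervalIntegrable _ _
    · exact (hd.continuous.comp (by fun_prop : Continuous fun s : ℝ => (x, s))).aestronglyMeasurable
    · refine Eventually.of_forall fun s hs y hy => hM ⟨(y, s), ⟨hy, uIoc_subset_uIcc hs⟩, rfl⟩
    · exact intervalIntegrable_const
    · refine Eventually.of_forall fun s _ y _ => ?_
      have h1 := ((hf1.differentiable one_ne_zero) (y, s)).hasFDerivAt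
      exact h1.comp y (hasFDerivAt_prodMk_left y s)

/-- The mean over the segment from `(b, t)` to `(a, t)` of the derivative of `g` in its first
variable. -/
noncomputable def meanFstDeriv (g : ℝ × ℝ → ℝ) (a b t : ℝ) : ℝ :=
  ∫ θ in (0 : ℝ)..1, fderiv ℝ g (b + θ * (a - b), t) (1, 0)

theorem continuous_meanFstDeriv {g : ℝ × ℝ → ℝ} (hg : ContDiff ℝ 1 g) :
    Continuous fun p : ℝ × ℝ × ℝ => meanFstDeriv g p.1 p.2.1 p.2.2 := by
  have := hg.continuous_fderiv one_ne_zero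
  unfold meanFstDeriv
  fun_prop

theorem meanFstDeriv_self (g : ℝ × ℝ → ℝ) (a t : ℝ) :
    meanFstDeriv g a a t = fderiv ℝ g (a, t) (1, 0) := by
  simp [meanFstDeriv]

theorem ContDiff.hasDerivAt_fst {g : ℝ × ℝ → ℝ} (hg : ContDiff ℝ 1 g) (a t : ℝ) :
    HasDerivAt (fun x => g (x, t)) (fderiv ℝ g (a, t) (1, 0)) a :=
  (hg.differentiable one_ne_zero (a, t)).hasFDerivAt.comp_hasDerivAt a
    ((hasDerivAt_id a).prodMk (hasDerivAt_const a t))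

theorem ContDiff.hasDerivAt_snd {g : ℝ × ℝ → ℝ} (hg : ContDiff ℝ 1 g) (a t : ℝ) :
    HasDerivAt (fun s => g (a, s)) (fderiv ℝ g (a, t) (0, 1)) t :=
  (hg.differentiable one_ne_zero (a, t)).hasFDerivAt.comp_hasDerivAt t
    ((hasDerivAt_const t a).prodMk (hasDerivAt_id t))

theorem sub_eq_meanFstDeriv_mul {g : ℝ × ℝ → ℝ} (hg : ContDiff ℝ 1 g) (a b t : ℝ) :
    g (a, t) - g (b, t) = meanFstDeriv g a b t * (a - b) := by
  have hc := hg.continuous_fderiv one_ne_zero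
  have h : ∀ θ ∈ uIcc (0 : ℝ) 1, HasDerivAt (fun θ => g (b + θ * (a - b), t))
      (fderiv ℝ g (b + θ * (a - b), t) (1, 0) * (a - b)) θ := fun θ _ => by
    have h1 : HasDerivAt (fun θ => b + θ * (a - b)) (a - b) θ := by
      simpa using ((hasDerivAt_id θ).mul_const (a - b)).const_add b
    exact (ContDiff.hasDerivAt_fst hg (b + θ * (a - b)) t).comp θ h1
  have := intervalIntegral.integral_eq_sub_of_hasDerivAt h
    (Continuous.intervalIntegrable (by fun_prop) _ _)
  simp only [meanFstDeriv, ← intervalIntegral.integral_mul_const]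
  rw [this]; simp

theorem abs_meanFstDeriv_le {g : ℝ × ℝ → ℝ} {K : ℝ} (hK : ∀ p, ‖fderiv ℝ g p‖ ≤ K) (a b t : ℝ) :
    |meanFstDeriv g a b t| ≤ K := by
  have := intervalIntegral.norm_integral_le_of_norm_le_const (a := 0) (b := 1) (C := K)
    (f := fun θ => fderiv ℝ g (b + θ * (a - b), t) (1, 0)) (fun θ _ => by
      refine (ContinuousLinearMap.le_opNorm _ _).trans ?_
      simpa using hK _)
  simpa [meanFstDeriv] using this

theorem sub_eq_sub_mul_exp_integral {g : ℝ × ℝ → ℝ} (hg : ContDiff ℝ 1 g) {γ₁ γ₂ : ℝ → ℝ}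
    (h₁ : ∀ t, HasDerivAt γ₁ (g (γ₁ t, t)) t) (h₂ : ∀ t, HasDerivAt γ₂ (g (γ₂ t, t)) t) (s t : ℝ) :
    γ₁ t - γ₂ t = (γ₁ s - γ₂ s) * Real.exp (∫ r in s..t, meanFstDeriv g (γ₁ r) (γ₂ r) r) := by
  have hc₁ : Continuous γ₁ := continuous_iff_continuousAt.2 fun t => (h₁ t).continuousAt
  have hc₂ : Continuous γ₂ := continuous_iff_continuousAt.2 fun t => (h₂ t).continuousAt
  have hq : Continuous fun r => meanFstDeriv g (γ₁ r) (γ₂ r) r :=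
    (continuous_meanFstDeriv hg).comp (hc₁.prodMk (hc₂.prodMk continuous_id))
  have hI : ∀ t, HasDerivAt (fun t => ∫ r in s..t, meanFstDeriv g (γ₁ r) (γ₂ r) r)
      (meanFstDeriv g (γ₁ t) (γ₂ t) t) t := fun t => hq.integral_hasStrictDerivAt s t |>.hasDerivAt
  have hD : ∀ t, HasDerivAt (fun t => (γ₁ t - γ₂ t) *
      Real.exp (-∫ r in s..t, meanFstDeriv g (γ₁ r) (γ₂ r) r)) 0 t := fun t => by
    refine (((h₁ t).sub (h₂ t)).mul (hI t).neg.exp).congr_deriv ?_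
    rw [sub_eq_meanFstDeriv_mul hg]
    simp only [Pi.sub_apply]
    ring
  have := is_const_of_deriv_eq_zero (fun t => (hD t).differentiableAt) (fun t => (hD t).deriv) t s
  simp only [intervalIntegral.integral_same, neg_zero, Real.exp_zero, mul_one] at this
  rw [← this, mul_assoc, ← Real.exp_add]
  simp

theorem contDiff_intervalIntegral_of_contDiff {H F : Type u} [NormedAddCommGroup H] [NormedSpace ℝ H]
    [LocallyCompactSpace H] [NormedAddCommGroup F] [NormedSpace ℝ F] [CompleteSpace F]
    {n : ℕ} {f : H × ℝ → F} (hf : ContDiff ℝ n f) {a b : H → ℝ} (ha : ContDiff ℝ n a)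
    (hb : ContDiff ℝ n b) : ContDiff ℝ n (fun x => ∫ s in a x..b x, f (x, s)) := by
  have h : ∀ x, ∫ s in a x..b x, f (x, s) =
      (b x - a x) • ∫ s in (0 : ℝ)..1, f (x, a x + (b x - a x) * s) := fun x => by
    rw [intervalIntegral.smul_integral_comp_add_mul (fun s => f (x, s))]
    simp
  simp only [h]
  exact (hb.sub ha).smul (contDiff_intervalIntegral_const 0 1 n
    (f := fun p : H × ℝ => f (p.1, a p.1 + (b p.1 - a p.1) * p.2)) (by fun_prop))

/-- `P (y, t)` is the value at time `t` of the characteristic of `g` through `y` at time `0`. -/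
structure IsCharacteristicFlow (g P : ℝ × ℝ → ℝ) : Prop where
  apply_zero : ∀ y, P (y, 0) = y
  hasDerivAt : ∀ y t, HasDerivAt (fun s => P (y, s)) (g (P (y, t), t)) t

namespace IsCharacteristicFlow

theorem sub_eq {g P : ℝ × ℝ → ℝ} (hP : IsCharacteristicFlow g P) (hg : ContDiff ℝ 1 g)
    (y z t : ℝ) : P (y, t) - P (z, t) =
      (y - z) * Real.exp (∫ r in (0 : ℝ)..t, meanFstDeriv g (P (y, r)) (P (z, r)) r) := by
  simpa [hP.apply_zero] using
    sub_eq_sub_mul_exp_integral hg (hP.hasDerivAt y) (hP.hasDerivAt z) 0 t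

theorem continuous {g P : ℝ × ℝ → ℝ} (hP : IsCharacteristicFlow g P) (hg : ContDiff ℝ 1 g)
    {K : ℝ} (hK : ∀ p, ‖fderiv ℝ g p‖ ≤ K) : Continuous P := by
  have hlip : ∀ y z t, |P (y, t) - P (z, t)| ≤ |y - z| * Real.exp (K * |t|) := fun y z t => by
    rw [hP.sub_eq hg, abs_mul, Real.abs_exp]
    gcongr
    refine (le_abs_self _).trans ?_
    simpa using intervalIntegral.norm_integral_le_of_norm_le_const (a := 0) (b := t) (C := K)
      (f := fun r => meanFstDeriv g (P (y, r)) (P (z, r)) r)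
      fun r _ => abs_meanFstDeriv_le hK (P (y, r)) (P (z, r)) r
  refine continuous_iff_continuousAt.2 fun ⟨y₀, t₀⟩ => ?_
  rw [ContinuousAt, tendsto_iff_norm_sub_tendsto_zero]
  have hlim : Tendsto (fun p : ℝ × ℝ => |p.1 - y₀| * Real.exp (K * |p.2|) +
      |P (y₀, p.2) - P (y₀, t₀)|) (𝓝 (y₀, t₀)) (𝓝 0) := by
    have h1 : ContinuousAt (fun t => P (y₀, t)) t₀ := (hP.hasDerivAt y₀ t₀).continuousAt
    have h2 : ContinuousAt (fun p : ℝ × ℝ => P (y₀, p.2)) (y₀, t₀) :=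
      ContinuousAt.comp (f := Prod.snd) (x := (y₀, t₀)) h1 continuousAt_snd
    have h3 : ContinuousAt (fun p : ℝ × ℝ => |p.1 - y₀| * Real.exp (K * |p.2|) +
      |P (y₀, p.2) - P (y₀, t₀)|) (y₀, t₀) :=
      ContinuousAt.add (by fun_prop) (h2.sub continuousAt_const).abs
    simpa [ContinuousAt] using h3
  refine squeeze_zero (fun _ => norm_nonneg _) (fun p => ?_) hlim
  calc ‖P p - P (y₀, t₀)‖ = |(P (p.1, p.2) - P (y₀, p.2)) + (P (y₀, p.2) - P (y₀, t₀))| := by simp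
    _ ≤ _ := (abs_add_le _ _).trans (by gcongr; exact hlip _ _ _)

theorem hasDerivAt_fst {g P : ℝ × ℝ → ℝ} (hP : IsCharacteristicFlow g P) (hg : ContDiff ℝ 1 g)
    (hc : Continuous P) (y t : ℝ) : HasDerivAt (fun z => P (z, t))
      (Real.exp (∫ r in (0 : ℝ)..t, fderiv ℝ g (P (y, r), r) (1, 0))) y := by
  have hm : Continuous fun z =>
      Real.exp (∫ r in (0 : ℝ)..t, meanFstDeriv g (P (z, r)) (P (y, r)) r) := by
    refine Real.continuous_exp.comp
      (intervalIntegral.continuous_parametric_intervalIntegral_of_continuous' ?_ 0 t)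
    exact (continuous_meanFstDeriv hg).comp
      (by fun_prop : Continuous fun p : ℝ × ℝ => (P (p.1, p.2), P (y, p.2), p.2))
  rw [hasDerivAt_iff_tendsto_slope]
  have := (hm.tendsto y).mono_left (nhdsWithin_le_nhds (s := {y}ᶜ))
  simp only [meanFstDeriv_self] at this
  refine this.congr' ?_
  filter_upwards [self_mem_nhdsWithin] with z hz
  rw [slope_def_field, hP.sub_eq hg, mul_div_cancel_left₀ _ (sub_ne_zero.2 hz)]

theorem hasStrictFDerivAt {g P : ℝ × ℝ → ℝ} (hP : IsCharacteristicFlow g P)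
    (hg : ContDiff ℝ 1 g) (hc : Continuous P) (p : ℝ × ℝ) :
    HasStrictFDerivAt P
      (Real.exp (∫ r in (0 : ℝ)..p.2, fderiv ℝ g (P (p.1, r), r) (1, 0)) •
        ContinuousLinearMap.fst ℝ ℝ ℝ + g (P p, p.2) • ContinuousLinearMap.snd ℝ ℝ ℝ) p := by
  have hg' := hg.continuous_fderiv one_ne_zero
  have hgc := hg.continuous
  let A : ℝ → ℝ → ℝ →L[ℝ] ℝ := fun y t => ContinuousLinearMap.toSpanSingleton ℝ
    (Real.exp (∫ r in (0 : ℝ)..t, fderiv ℝ g (P (y, r), r) (1, 0)))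
  let B : ℝ → ℝ → ℝ →L[ℝ] ℝ := fun y t => ContinuousLinearMap.toSpanSingleton ℝ (g (P (y, t), t))
  have hA : Continuous fun p : ℝ × ℝ => A p.1 p.2 := by
    refine (ContinuousLinearMap.toSpanSingletonCLE (𝕜 := ℝ) (E := ℝ)).continuous.comp
      (Real.continuous_exp.comp ?_)
    exact intervalIntegral.continuous_parametric_intervalIntegral_of_continuous
      (f := fun (p : ℝ × ℝ) r => fderiv ℝ g (P (p.1, r), r) (1, 0)) (by fun_prop) continuous_snd
  have hB : Continuous fun p : ℝ × ℝ => B p.1 p.2 :=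
    (ContinuousLinearMap.toSpanSingletonCLE (𝕜 := ℝ) (E := ℝ)).continuous.comp
      (f := fun p : ℝ × ℝ => g (P (p.1, p.2), p.2)) (by fun_prop)
  have := hasStrictFDerivAt_uncurry_coprod (u := p) (f := fun y t => P (y, t)) (f₁ := A) (f₂ := B)
    (Eventually.of_forall fun v => (hP.hasDerivAt_fst hg hc v.1 v.2).hasFDerivAt)
    (Eventually.of_forall fun v => (hP.hasDerivAt v.1 v.2).hasFDerivAt)
    hA.continuousAt hB.continuousAt
  refine this.congr_fderiv ?_
  ext <;> simp [A, B, Function.HasUncurry.uncurry]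

theorem contDiff {g P : ℝ × ℝ → ℝ} (hP : IsCharacteristicFlow g P)
    (hg : ContDiff ℝ (⊤ : ℕ∞) g) (hc : Continuous P) : ContDiff ℝ (⊤ : ℕ∞) P := by
  have hg1 : ContDiff ℝ 1 g := hg.of_le (by norm_cast)
  refine contDiff_infty.2 fun n => ?_
  induction n with
  | zero => simpa using hc
  | succ n ih =>
    have hgn : ContDiff ℝ n g := hg.of_le (by norm_cast; exact le_top)
    have hgn' : ContDiff ℝ n (fderiv ℝ g) := hg.fderiv_right (m := n) (by norm_cast; exact le_top)
    push_cast
    refine contDiff_succ_iff_hasFDerivAt.2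
      ⟨_, ?_, fun p => (hP.hasStrictFDerivAt hg1 hc p).hasFDerivAt⟩
    have hint : ContDiff ℝ n fun p : ℝ × ℝ =>
        ∫ r in (0 : ℝ)..p.2, fderiv ℝ g (P (p.1, r), r) (1, 0) :=
      contDiff_intervalIntegral_of_contDiff
        (f := fun q : (ℝ × ℝ) × ℝ => fderiv ℝ g (P (q.1.1, q.2), q.2) (1, 0))
        (by fun_prop) contDiff_const contDiff_snd
    fun_prop

end IsCharacteristicFlow

theorem exists_characteristic {g : ℝ × ℝ → ℝ} (hg : ContDiff ℝ 1 g) (hcs : HasCompactSupport g)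
    (x t : ℝ) : ∃ γ : ℝ → ℝ, γ t = x ∧ ∀ s, HasDerivAt γ (g (γ s, s)) s := by
  obtain ⟨K, hK⟩ := ContDiff.lipschitzWith_of_hasCompactSupport hcs hg one_ne_zero
  obtain ⟨C, hC⟩ := hcs.exists_bound_of_continuous hg.continuous
  refine exists_forall_hasDerivAt_of_lipschitzWith_of_norm_le (v := fun s y => g (y, s)) (K := K)
    (C := C.toNNReal) (fun s => ?_) (fun y => ?_) (fun s y => (hC _).trans (Real.le_coe_toNNReal C))
    t x
  · simpa [Function.comp_def] using hK.comp (LipschitzWith.prodMk_right s)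
  · exact hg.continuous.comp (by fun_prop)

theorem exists_isCharacteristicFlow {g : ℝ × ℝ → ℝ} (hg : ContDiff ℝ 1 g)
    (hcs : HasCompactSupport g) : ∃ P, IsCharacteristicFlow g P := by
  choose γ h0 h1 using fun y => exists_characteristic hg hcs y 0
  exact ⟨fun p => γ p.1 p.2, h0, h1⟩

/-- The foot at time `0` of the characteristic through a point depends smoothly on the point. -/
theorem IsCharacteristicFlow.exists_contDiff_foot {g P : ℝ × ℝ → ℝ}
    (hP : IsCharacteristicFlow g P) (hg : ContDiff ℝ (⊤ : ℕ∞) g) (hcs : HasCompactSupport g)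
    (hc : Continuous P) : ∃ R : ℝ × ℝ → ℝ, ContDiff ℝ (⊤ : ℕ∞) R ∧
      (∀ x t, P (R (x, t), t) = x) ∧ ∀ y t, R (P (y, t), t) = y := by
  have hg1 : ContDiff ℝ 1 g := hg.of_le (by norm_cast)
  have hPs := hP.contDiff hg hc
  let S : ℝ × ℝ → ℝ × ℝ := fun p => (P p, p.2)
  have hS : ContDiff ℝ (⊤ : ℕ∞) S := hPs.prodMk contDiff_snd
  have hinj : Function.Injective S := by
    rintro ⟨y, t⟩ ⟨z, s⟩ h
    obtain ⟨h1, rfl⟩ : P (y, t) = P (z, s) ∧ t = s := by simpa [S] using h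
    have := hP.sub_eq hg1 y z t
    rw [h1, sub_self, eq_comm, mul_eq_zero, or_iff_left (Real.exp_pos _).ne', sub_eq_zero] at this
    rw [this]
  have hsurj : Function.Surjective S := by
    rintro ⟨x, t⟩
    obtain ⟨γ, h0, h1⟩ := exists_characteristic hg1 hcs x t
    have := sub_eq_sub_mul_exp_integral hg1 (hP.hasDerivAt (γ 0)) h1 0 t
    rw [hP.apply_zero, sub_self, zero_mul, sub_eq_zero, h0] at this
    exact ⟨(γ 0, t), by simp [S, this]⟩
  have hS' : ∀ p, ∃ e : (ℝ × ℝ) ≃L[ℝ] ℝ × ℝ,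
      HasStrictFDerivAt S (e : ℝ × ℝ →L[ℝ] ℝ × ℝ) p := fun p => by
    have h := (hP.hasStrictFDerivAt hg1 hc p).prodMk hasStrictFDerivAt_snd
    set D := (Real.exp (∫ r in (0 : ℝ)..p.2, fderiv ℝ g (P (p.1, r), r) (1, 0)) •
        ContinuousLinearMap.fst ℝ ℝ ℝ + g (P p, p.2) • ContinuousLinearMap.snd ℝ ℝ ℝ).prod
        (ContinuousLinearMap.snd ℝ ℝ ℝ)
    have hD : Function.Injective D := by
      refine (injective_iff_map_eq_zero D).2 fun ⟨a, b⟩ hab => ?_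
      obtain ⟨h1, h2⟩ := Prod.ext_iff.1 hab
      obtain rfl : b = 0 := h2
      simpa [D] using h1
    exact ⟨(LinearEquiv.ofInjectiveEndo D.toLinearMap hD).toContinuousLinearEquiv,
      h.congr_fderiv (by ext <;> rfl)⟩
  choose e he using hS'
  let Φ : (ℝ × ℝ) ≃ₜ ℝ × ℝ := (Equiv.ofBijective S ⟨hinj, hsurj⟩).toHomeomorphOfContinuousOpen
    hS.continuous (isOpenMap_of_hasStrictFDerivAt_equiv he)
  have hΦ : ∀ p, Φ p = S p := fun _ => rfl
  refine ⟨fun q => (Φ.symm q).1,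
    contDiff_fst.comp (Φ.contDiff_symm (fun p => (he p).hasFDerivAt) hS),
    fun x t => ?_, fun y t => ?_⟩
  · have h := Φ.apply_symm_apply (x, t)
    obtain ⟨h1, h2⟩ := Prod.ext_iff.1 ((hΦ _).symm.trans h)
    dsimp only [S] at h1 h2
    convert h1 using 2
    exact Prod.ext rfl h2.symm
  · exact congrArg Prod.fst (Φ.symm_apply_apply (y, t))

/-- Backward solution of `ψ_t + g ψ_x = φ` by integration along the characteristics of `g`. -/
theorem exists_contDiff_transport {g φ : ℝ × ℝ → ℝ} (hg : ContDiff ℝ (⊤ : ℕ∞) g)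
    (hcs : HasCompactSupport g) (hφ : ContDiff ℝ (⊤ : ℕ∞) φ) (T : ℝ) :
    ∃ ψ : ℝ × ℝ → ℝ, ContDiff ℝ (⊤ : ℕ∞) ψ ∧
      (∀ x t, deriv (fun s => ψ (x, s)) t + g (x, t) * deriv (fun y => ψ (y, t)) x = φ (x, t)) ∧
      ∀ x t, ∃ γ : ℝ → ℝ, γ t = x ∧ (∀ s, HasDerivAt γ (g (γ s, s)) s) ∧
        ψ (x, t) = -∫ s in t..T, φ (γ s, s) := by
  have hg1 : ContDiff ℝ 1 g := hg.of_le (by norm_cast)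
  obtain ⟨K, hK⟩ := (hcs.fderiv ℝ).exists_bound_of_continuous (hg1.continuous_fderiv one_ne_zero)
  obtain ⟨P, hP⟩ := exists_isCharacteristicFlow hg1 hcs
  have hc := hP.continuous hg1 hK
  have hPs := hP.contDiff hg hc
  obtain ⟨R, hR, hPR, hRP⟩ := hP.exists_contDiff_foot hg hcs hc
  have hφc := hφ.continuous
  let ψ : ℝ × ℝ → ℝ := fun p => -∫ s in p.2..T, φ (P (R p, s), s)
  have hψ : ContDiff ℝ (⊤ : ℕ∞) ψ := contDiff_infty.2 fun n => by
    have hle : (n : WithTop ℕ∞) ≤ ((⊤ : ℕ∞) : WithTop ℕ∞) := by norm_cast; exact le_top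
    have h1 := hφ.of_le hle
    have h2 := hPs.of_le hle
    have h3 := hR.of_le hle
    exact (contDiff_intervalIntegral_of_contDiff
      (f := fun q : (ℝ × ℝ) × ℝ => φ (P (R q.1, q.2), q.2))
      (by fun_prop) contDiff_snd contDiff_const).neg
  have hψ1 : ContDiff ℝ 1 ψ := hψ.of_le (by norm_cast)
  refine ⟨ψ, hψ, fun x t => ?_, fun x t => ⟨fun s => P (R (x, t), s), hPR x t,
    hP.hasDerivAt _, rfl⟩⟩
  obtain ⟨y, rfl⟩ : ∃ y, x = P (y, t) := ⟨R (x, t), (hPR x t).symm⟩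
  have hleft : HasDerivAt (fun s => ψ (P (y, s), s))
      (fderiv ℝ ψ (P (y, t), t) (g (P (y, t), t), 1)) t :=
    (hψ1.differentiable one_ne_zero (P (y, t), t)).hasFDerivAt.comp_hasDerivAt
      (f := fun s => (P (y, s), s)) t ((hP.hasDerivAt y t).prodMk (hasDerivAt_id' t))
  have hright : HasDerivAt (fun s => ψ (P (y, s), s)) (φ (P (y, t), t)) t := by
    have hcont : Continuous fun s => φ (P (y, s), s) := by fun_prop
    have h := hcont.integral_hasStrictDerivAt T t |>.hasDerivAt
    refine h.congr_of_eventuallyEq (Eventually.of_forall fun s => ?_)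
    simp only [ψ, hRP]
    rw [intervalIntegral.integral_symm, neg_neg]
  rw [(ContDiff.hasDerivAt_fst hψ1 _ t).deriv, (ContDiff.hasDerivAt_snd hψ1 _ t).deriv,
    hright.unique hleft, ← smul_eq_mul, ← map_smul, ← map_add]
  simp

/-- Maximum principle for the transport equation on a strip. -/
theorem transport_nonpos {T : ℝ} {G w : ℝ × ℝ → ℝ} (hw : ContDiff ℝ 1 w)
    (hpde : ∀ x, ∀ t ∈ Ioo 0 T,
      deriv (fun s => w (x, s)) t + G (x, t) * deriv (fun y => w (y, t)) x = 0)
    (hwT : ∀ x, w (x, T) = 0) {K : Set (ℝ × ℝ)} (hK : IsCompact K)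
    (hwK : ∀ p : ℝ × ℝ, p.2 ∈ Icc 0 T → w p ≠ 0 → p ∈ K) (x t : ℝ) (ht : t ∈ Ioo 0 T) :
    w (x, t) ≤ 0 := by
  by_contra! hpos
  obtain ⟨ε, hε, hεw⟩ : ∃ ε > 0, ε * (T - t) < w (x, t) :=
    ⟨w (x, t) / (2 * (T - t)), div_pos hpos (by linarith [ht.2]), by
      have : T - t ≠ 0 := by linarith [ht.2]
      field_simp
      linarith⟩
  let v : ℝ × ℝ → ℝ := fun p => w p - ε * (T - p.2)
  have hv : Continuous v := by
    have := hw.continuous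
    fun_prop
  have hvpos : 0 < v (x, t) := sub_pos.2 hεw
  have hmem : ∀ p : ℝ × ℝ, p.2 ∈ Icc t T → 0 < v p → p ∈ K := fun p hp hvp =>
    hwK p ⟨ht.1.le.trans hp.1, hp.2⟩ fun h => by
      have := mul_nonneg hε.le (sub_nonneg.2 hp.2)
      simp only [v, h] at hvp
      linarith
  have hxt : (x, t).2 ∈ Icc t T := ⟨le_rfl, ht.2.le⟩
  obtain ⟨⟨x₁, t₁⟩, ⟨-, ht₁⟩, hmax⟩ := (hK.inter_right (isClosed_Icc.preimage continuous_snd :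
    IsClosed {p : ℝ × ℝ | p.2 ∈ Icc t T})).exists_isMaxOn
    ⟨(x, t), hmem _ hxt hvpos, hxt⟩ hv.continuousOn
  have hv₁ : 0 < v (x₁, t₁) := hvpos.trans_le (hmax ⟨hmem _ hxt hvpos, hxt⟩)
  have hle : ∀ p : ℝ × ℝ, p.2 ∈ Icc t T → v p ≤ v (x₁, t₁) := fun p hp => by
    by_cases h : 0 < v p
    · exact hmax ⟨hmem p hp h, hp⟩
    · exact (not_lt.1 h).trans hv₁.le
  have ht₁T : t₁ < T := ht₁.2.lt_of_ne fun h => by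
    simp only at h
    simp [v, h, hwT] at hv₁
  have hx₁ : deriv (fun y => w (y, t₁)) x₁ = 0 := by
    refine IsLocalMax.deriv_eq_zero (Eventually.of_forall fun y => ?_)
    have := hle (y, t₁) ht₁
    simp only [v] at this
    linarith
  have hdt := hpde x₁ t₁ ⟨ht.1.trans_le ht₁.1, ht₁T⟩
  rw [hx₁, mul_zero, add_zero] at hdt
  have hwt : HasDerivAt (fun s => w (x₁, s)) 0 t₁ :=
    hdt ▸ (hw.hasDerivAt_snd x₁ t₁).differentiableAt.hasDerivAt
  have hvt : HasDerivAt (fun s => v (x₁, s)) ε t₁ := by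
    have h := hwt.sub (((hasDerivAt_id' t₁).const_sub T).const_mul ε)
    refine h.congr_deriv (by ring)
  have hslope := (hasDerivAt_iff_tendsto_slope.1 hvt).mono_left
    (nhdsWithin_mono t₁ (s := Ioi t₁) (fun s hs => ne_of_gt hs))
  have hev := (hslope.eventually (lt_mem_nhds hε)).and (Ioo_mem_nhdsGT ht₁T)
  obtain ⟨s, hs, hs'⟩ := hev.exists
  rw [slope_def_field] at hs
  have h1 := (div_pos_iff_of_pos_right (sub_pos.2 hs'.1)).1 hs
  have h2 := hle (x₁, s) ⟨ht₁.1.trans hs'.1.le, hs'.2.le⟩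
  linarith

theorem transport_eq_zero {T : ℝ} (hT : 0 < T) {G w : ℝ × ℝ → ℝ} (hw : ContDiff ℝ 1 w)
    (hpde : ∀ x, ∀ t ∈ Ioo 0 T,
      deriv (fun s => w (x, s)) t + G (x, t) * deriv (fun y => w (y, t)) x = 0)
    (hwT : ∀ x, w (x, T) = 0) {K : Set (ℝ × ℝ)} (hK : IsCompact K)
    (hwK : ∀ p : ℝ × ℝ, p.2 ∈ Icc 0 T → w p ≠ 0 → p ∈ K) (x t : ℝ) (ht : t ∈ Icc 0 T) :
    w (x, t) = 0 := by
  have hIoo : Ioo 0 T ⊆ {s | w (x, s) = 0} := fun s hs => by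
    refine le_antisymm (transport_nonpos hw hpde hwT hK hwK x s hs) ?_
    have := transport_nonpos (G := G) (w := -w) hw.neg (fun y r hr => ?_) (fun y => by simp [hwT]) hK
      (fun p hp h => hwK p hp (by simpa using h)) x s hs
    · simpa using this
    · simp only [Pi.neg_apply, deriv.fun_neg]
      linarith [hpde y r hr]
  have hcl : IsClosed {s | w (x, s) = 0} := by
    have := hw.continuous
    exact isClosed_eq (by fun_prop) continuous_const
  have := hcl.closure_subset_iff.2 hIoo
  rw [closure_Ioo hT.ne] at this
  exact this ht

/-- Solvability of the dual linear transport problem: for smooth `G`,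
bounded with bounded `x`-derivative on the strip `ℝ × [0,T]`, and `φ ∈ C_c^∞(ℝ × (0,T))`,
there is a unique smooth `ψ` on the strip solving `ψ_t + G ψ_x = φ` with `ψ(·,T) = 0`;
moreover `ψ` has compact support contained in `ℝ × [0,T)`. -/
theorem dual_transport_solvability
    (T : ℝ) (hT : 0 < T)
    (G : ℝ × ℝ → ℝ) (hG : ContDiff ℝ (⊤ : ℕ∞) G)
    (hGbdd : ∃ C : ℝ, ∀ p : ℝ × ℝ, p.2 ∈ Set.Icc 0 T →
      |G p| ≤ C ∧ |deriv (fun y => G (y, p.2)) p.1| ≤ C)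
    (φ : ℝ × ℝ → ℝ) (hφ : ContDiff ℝ (⊤ : ℕ∞) φ) (hφcs : HasCompactSupport φ)
    (hφsupp : tsupport φ ⊆ Set.univ ×ˢ Set.Ioo (0:ℝ) T) :
    ∃ ψ : ℝ × ℝ → ℝ,
      (ContDiff ℝ (⊤ : ℕ∞) ψ ∧
        (∀ x : ℝ, ∀ t ∈ Set.Ioo (0:ℝ) T,
          deriv (fun s => ψ (x, s)) t + G (x, t) * deriv (fun y => ψ (y, t)) x
            = φ (x, t)) ∧
        (∀ x : ℝ, ψ (x, T) = 0) ∧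
        IsCompact (closure {p : ℝ × ℝ | p.2 ∈ Set.Icc 0 T ∧ ψ p ≠ 0}) ∧
        closure {p : ℝ × ℝ | p.2 ∈ Set.Icc 0 T ∧ ψ p ≠ 0}
          ⊆ Set.univ ×ˢ Set.Ico 0 T) ∧
      ∀ ψ' : ℝ × ℝ → ℝ,
        (ContDiff ℝ (⊤ : ℕ∞) ψ' ∧
          (∀ x : ℝ, ∀ t ∈ Set.Ioo (0:ℝ) T,
            deriv (fun s => ψ' (x, s)) t + G (x, t) * deriv (fun y => ψ' (y, t)) x
              = φ (x, t)) ∧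
          (∀ x : ℝ, ψ' (x, T) = 0) ∧
          IsCompact (closure {p : ℝ × ℝ | p.2 ∈ Set.Icc 0 T ∧ ψ' p ≠ 0}) ∧
          closure {p : ℝ × ℝ | p.2 ∈ Set.Icc 0 T ∧ ψ' p ≠ 0}
            ⊆ Set.univ ×ˢ Set.Ico 0 T) →
        ∀ p : ℝ × ℝ, p.2 ∈ Set.Icc 0 T → ψ' p = ψ p := by
  obtain ⟨C, hC⟩ := hGbdd
  have hC0 : 0 ≤ C := (abs_nonneg _).trans (hC (0, 0) ⟨le_rfl, hT.le⟩).1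
  obtain ⟨R₀, hR₀⟩ := hφcs.isCompact.isBounded.exists_norm_le
  have hφR : ∀ p, φ p ≠ 0 → |p.1| ≤ R₀ := fun p hp =>
    (norm_fst_le p).trans (hR₀ p (subset_tsupport φ hp))
  obtain ⟨b, hbT, hφb⟩ : ∃ b, b < T ∧ ∀ p, φ p ≠ 0 → p.2 ≤ b := by
    obtain ⟨q, hq, hmax⟩ := (hφcs.isCompact.insert (0, 0)).exists_isMaxOn (insert_nonempty _ _)
      continuous_snd.continuousOn
    refine ⟨q.2, ?_, fun p hp => hmax (mem_insert_of_mem _ (subset_tsupport φ hp))⟩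
    rcases hq with rfl | hq
    · exact hT
    · exact (hφsupp hq).2.2
  set R₁ := R₀ + C * T
  let f : ContDiffBump (0 : ℝ × ℝ) :=
    ⟨|R₁| + T + 1, |R₁| + T + 2, by positivity, by linarith⟩
  let g : ℝ × ℝ → ℝ := fun p => f p * G p
  have hg : ContDiff ℝ (⊤ : ℕ∞) g := f.contDiff.mul hG
  have hgcs : HasCompactSupport g := f.hasCompactSupport.mul_right
  have hgC : ∀ x, ∀ t ∈ Icc 0 T, |g (x, t)| ≤ C := fun x t ht => by
    rw [abs_mul, abs_of_nonneg f.nonneg]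
    exact (mul_le_of_le_one_left (abs_nonneg _) f.le_one).trans (hC (x, t) ht).1
  have hgG : ∀ x, ∀ t ∈ Icc 0 T, |x| ≤ R₁ → g (x, t) = G (x, t) := fun x t ht hx => by
    have : f (x, t) = 1 := f.one_of_mem_closedBall <| by
      rw [mem_closedBall_zero_iff, Prod.norm_def, max_le_iff, Real.norm_eq_abs, Real.norm_eq_abs,
        abs_of_nonneg ht.1]
      constructor <;> simp only [f] <;> linarith [ht.2, le_abs_self R₁, abs_nonneg R₁]
    simp [g, this]
  obtain ⟨ψ, hψ, hpde, hrep⟩ := exists_contDiff_transport hg hgcs hφ T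
  have hsupp : ∀ x, ∀ t ∈ Icc 0 T, ψ (x, t) ≠ 0 → |x| ≤ R₁ ∧ t ≤ b := fun x t ht hne => by
    obtain ⟨γ, rfl, hγ, hψγ⟩ := hrep x t
    obtain ⟨s, hs, hφs⟩ : ∃ s ∈ Icc t T, φ (γ s, s) ≠ 0 := by
      by_contra! h
      rw [hψγ, intervalIntegral.integral_congr (g := fun _ => (0 : ℝ))
        (fun s hs => h s (uIcc_of_le ht.2 ▸ hs))] at hne
      simp at hne
    refine ⟨?_, hs.1.trans (hφb _ hφs)⟩
    have hdist := (convex_Icc t s).norm_image_sub_le_of_norm_hasDerivWithin_le (f := γ) (C := C)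
      (fun r _ => (hγ r).hasDerivWithinAt)
      (fun r hr => hgC _ r ⟨ht.1.trans hr.1, hr.2.trans hs.2⟩)
      (right_mem_Icc.2 hs.1) (left_mem_Icc.2 hs.1)
    rw [Real.norm_eq_abs, Real.norm_eq_abs, abs_sub_comm t s,
      abs_of_nonneg (sub_nonneg.2 hs.1)] at hdist
    calc |γ t| = |γ s + (γ t - γ s)| := by rw [add_sub_cancel]
      _ ≤ |γ s| + |γ t - γ s| := abs_add_le _ _
      _ ≤ R₀ + C * T := add_le_add (hφR _ hφs)
        (hdist.trans (mul_le_mul_of_nonneg_left (by linarith [ht.1, hs.2]) hC0))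
  have hcl : closure {p : ℝ × ℝ | p.2 ∈ Icc 0 T ∧ ψ p ≠ 0} ⊆ Icc (-R₁) R₁ ×ˢ Icc 0 b :=
    closure_minimal (fun p hp =>
      have h := hsupp p.1 p.2 hp.1 hp.2
      ⟨abs_le.1 h.1, hp.1.1, h.2⟩) (isClosed_Icc.prod isClosed_Icc)
  have hcpt := (isCompact_Icc.prod isCompact_Icc).of_isClosed_subset isClosed_closure hcl
  have hpdeG : ∀ x : ℝ, ∀ t ∈ Ioo (0 : ℝ) T,
      deriv (fun s => ψ (x, s)) t + G (x, t) * deriv (fun y => ψ (y, t)) x = φ (x, t) := by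
    intro x t ht
    rw [← hpde x t]
    rcases le_or_gt |x| R₁ with hx | hx
    · rw [hgG x t (Ioo_subset_Icc_self ht) hx]
    · have hzero : (fun y => ψ (y, t)) =ᶠ[𝓝 x] fun _ => 0 := by
        filter_upwards [continuous_abs.continuousAt.eventually (lt_mem_nhds hx)] with y hy
        by_contra hne
        exact hy.not_ge (hsupp y t (Ioo_subset_Icc_self ht) hne).1
      simp [hzero.deriv_eq]
  have hψT : ∀ x, ψ (x, T) = 0 := fun x => by
    obtain ⟨γ, -, -, h⟩ := hrep x T
    simpa using h
  refine ⟨ψ, ⟨hψ, hpdeG, hψT, hcpt, hcl.trans (prod_mono (subset_univ _)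
    fun t ht => ⟨ht.1, ht.2.trans_lt hbT⟩)⟩, ?_⟩
  rintro ψ' ⟨hψ', hpde', hψT', hcpt', -⟩ ⟨x, t⟩ ht
  have h1 : ContDiff ℝ 1 ψ := hψ.of_le (by norm_cast)
  have h1' : ContDiff ℝ 1 ψ' := hψ'.of_le (by norm_cast)
  refine sub_eq_zero.1 (transport_eq_zero hT (G := G) (w := fun p => ψ' p - ψ p) (h1'.sub h1)
    (fun x t ht => ?_) (fun x => by simp [hψT, hψT']) (hcpt'.union hcpt) (fun p hp hne => ?_) x t ht)
  · rw [deriv_fun_sub (h1'.hasDerivAt_snd x t).differentiableAt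
      (h1.hasDerivAt_snd x t).differentiableAt,
      deriv_fun_sub (h1'.hasDerivAt_fst x t).differentiableAt
      (h1.hasDerivAt_fst x t).differentiableAt]
    linear_combination hpde' x t ht - hpdeG x t ht
  · by_cases h : ψ' p = 0
    · exact Or.inr (subset_closure ⟨hp, fun h0 => hne (by simp [h, h0])⟩)
    · exact Or.inl (subset_closure ⟨hp, h⟩)
end
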